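/- Suppose the conic MIP is feasible, and let π ∈ ℝ^{n₁}, γ ∈ ℝ^{n₂}, π₀ ∈ ℝ define a valid inequality for its feasible region, i.e., π·x + γ·y ≥ π₀ for every x ∈ ℤ^{n₁}, y ∈ ℝ^{n₂} with Ax + Gy − b ∈ K. Suppose there exists f ∈ 𝓕_K with f(0) = 0, f(A^j) = −f(−A^j) = π_j for j = 1,…,n₁, and f̄(G^j) = −f̄(−G^j) = γ_j for j = 1,…,n₂. Then there exists F ∈ 𝓕_K with F(0) = 0, F(A^j) = −F(−A^j) = π_j for j = 1,…,n₁, F̄(G^j) = −F̄(−G^j) = γ_j for j = 1,…,n₂, and F(b) ≥ π₀. -/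

import Mathlib

/-!
STATEMENT 16: If a valid inequality `π·x + γ·y ≥ π₀` for the feasible region of a
feasible conic MIP has coefficients realizable by some `f ∈ 𝓕_K` (with `f 0 = 0`),
then there is such an `F` which additionally satisfies `F b ≥ π₀`.
-/

/-- A regular cone: closed, convex, closed under nonnegative scaling,
pointed (`K ∩ (-K) = {0}`) and full-dimensional (nonempty interior). -/
def IsRegularCone {m : ℕ} (K : Set (Fin m → ℝ)) : Prop :=
  IsClosed K ∧ Convex ℝ K ∧ (∀ x ∈ K, ∀ t : ℝ, 0 ≤ t → t • x ∈ K) ∧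
    K ∩ (-K) = {0} ∧ (interior K).Nonempty

/-- `f̄ w = limsup_{δ → 0⁺} f (δ w) / δ`, in the extended reals. -/
noncomputable def fbar {m : ℕ} (f : (Fin m → ℝ) → ℝ) (w : Fin m → ℝ) : EReal :=
  Filter.limsup (fun δ : ℝ => ((f (δ • w) / δ : ℝ) : EReal)) (nhdsWithin 0 (Set.Ioi 0))

/-- Feasibility of `f` for the subadditive dual of the conic MIP
`inf {c·x + d·y : A x + G y - b ∈ K, x ∈ ℤ^{n₁}, y ∈ ℝ^{n₂}}`:
`f` is subadditive, nondecreasing with respect to `K`, `f 0 = 0`,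
`f(A^j) = -f(-A^j) = c_j` and `f̄(G^j) = -f̄(-G^j) = d_j`. -/
def DualFeasible {m n1 n2 : ℕ} (K : Set (Fin m → ℝ))
    (A : Matrix (Fin m) (Fin n1) ℝ) (G : Matrix (Fin m) (Fin n2) ℝ)
    (c : Fin n1 → ℝ) (d : Fin n2 → ℝ) (f : (Fin m → ℝ) → ℝ) : Prop :=
  (∀ u v, f (u + v) ≤ f u + f v) ∧
  (∀ u v, u - v ∈ K → f v ≤ f u) ∧
  f 0 = 0 ∧
  (∀ j, f (fun i => A i j) = c j ∧ f (fun i => -A i j) = -c j) ∧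
  (∀ j, fbar f (fun i => G i j) = ((d j : ℝ) : EReal) ∧
        fbar f (fun i => -G i j) = ((-d j : ℝ) : EReal))

section Subadditive

variable {E P : Type*} [AddCommGroup E] [AddCommGroup P]

theorem map_nsmul_le_of_subadditive {f : E → ℝ} (hadd : ∀ u v, f (u + v) ≤ f u + f v)
    (h0 : f 0 = 0) (n : ℕ) (w : E) : f (n • w) ≤ n * f w := by
  induction n with
  | zero => simp [h0]
  | succ k ih =>
    rw [succ_nsmul]
    push_cast
    linarith [hadd (k • w) w]

theorem map_zsmul_le_of_subadditive {f : E → ℝ} (hadd : ∀ u v, f (u + v) ≤ f u + f v)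
    (h0 : f 0 = 0) {w : E} (hneg : f (-w) = -f w) (z : ℤ) : f (z • w) ≤ z * f w := by
  obtain ⟨n, rfl | rfl⟩ := z.eq_nat_or_neg
  · simpa using map_nsmul_le_of_subadditive hadd h0 n w
  · have h := map_nsmul_le_of_subadditive hadd h0 n (-w)
    rw [hneg] at h
    simpa using h

theorem eq_of_subadditive_of_le {f : E → ℝ} (hadd : ∀ u v, f (u + v) ≤ f u + f v) (h0 : f 0 = 0)
    {M : P →+ E} {l : P →+ ℝ} (hl : ∀ p, f (M p) ≤ l p) (p : P) : f (M p) = l p := by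
  have h1 := hl (-p)
  have h2 := hadd (M p) (M (-p))
  rw [← map_add, add_neg_cancel, map_zero, h0] at h2
  rw [map_neg l] at h1
  exact le_antisymm (hl p) (by linarith)

/-- The infimal convolution of `h` with the function equal to `l p` at each point `M p`
and to `+∞` off the range of `M`. -/
noncomputable def infConvHom (M : P →+ E) (l : P →+ ℝ) (h : E → ℝ) (u : E) : ℝ :=
  ⨅ p, (l p + h (u - M p))

variable {M : P →+ E} {l : P →+ ℝ} {f h : E → ℝ}

theorem le_add_of_subadditive (hadd : ∀ u v, f (u + v) ≤ f u + f v)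
    (hl : ∀ p, f (M p) ≤ l p) (hfh : ∀ u, f u ≤ h u) (u : E) (p : P) :
    f u ≤ l p + h (u - M p) := by
  have h1 := hadd (M p) (u - M p)
  rw [add_sub_cancel] at h1
  linarith [hl p, hfh (u - M p)]

theorem le_infConvHom (hfh : ∀ u p, f u ≤ l p + h (u - M p)) (u : E) :
    f u ≤ infConvHom M l h u :=
  le_ciInf (hfh u)

theorem infConvHom_le (hfh : ∀ u p, f u ≤ l p + h (u - M p)) (u : E) (p : P) :
    infConvHom M l h u ≤ l p + h (u - M p) :=
  ciInf_le ⟨f u, by rintro _ ⟨q, rfl⟩; exact hfh u q⟩ p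

theorem infConvHom_add_le (hfh : ∀ u p, f u ≤ l p + h (u - M p))
    (hadd : ∀ u v, h (u + v) ≤ h u + h v) (u v : E) :
    infConvHom M l h (u + v) ≤ infConvHom M l h u + infConvHom M l h v := by
  refine le_ciInf_add_ciInf fun p q => ?_
  have h1 := infConvHom_le hfh (u + v) (p + q)
  have h2 := hadd (u - M p) (v - M q)
  rw [map_add, map_add, add_sub_add_comm] at h1
  linarith

theorem infConvHom_mono (hfh : ∀ u p, f u ≤ l p + h (u - M p)) {K : Set E}
    (hmono : ∀ u v, u - v ∈ K → h v ≤ h u) (u v : E) (huv : u - v ∈ K) :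
    infConvHom M l h v ≤ infConvHom M l h u := by
  refine le_ciInf fun p => (infConvHom_le hfh v p).trans ?_
  have := hmono (u - M p) (v - M p) (by simpa using huv)
  linarith

end Subadditive

theorem map_smul_le_of_fbar {m : ℕ} {f : (Fin m → ℝ) → ℝ}
    (hadd : ∀ u v, f (u + v) ≤ f u + f v) (h0 : f 0 = 0) {w : Fin m → ℝ} {c : ℝ}
    (hc : fbar f w = (c : EReal)) {t : ℝ} (ht : 0 < t) : f (t • w) ≤ t * c := by
  have hlim : Filter.Tendsto (fun n : ℕ => t / ((n : ℝ) + 1)) Filter.atTop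
      (nhdsWithin 0 (Set.Ioi 0)) := by
    refine tendsto_nhdsWithin_iff.2 ⟨?_, Filter.Eventually.of_forall fun n => ?_⟩
    · simpa [div_eq_mul_inv] using (tendsto_one_div_add_atTop_nhds_zero_nat (𝕜 := ℝ)).const_mul t
    · exact div_pos ht (by positivity)
  have hev : ∀ n : ℕ, ((f (t • w) / t : ℝ) : EReal) ≤
      ((f ((t / ((n : ℝ) + 1)) • w) / (t / ((n : ℝ) + 1)) : ℝ) : EReal) := by
    intro n
    have hn : (0 : ℝ) < (n : ℝ) + 1 := by positivity
    have h := map_nsmul_le_of_subadditive hadd h0 (n + 1) ((t / ((n : ℝ) + 1)) • w)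
    rw [← Nat.cast_smul_eq_nsmul ℝ, smul_smul] at h
    push_cast at h
    rw [mul_div_cancel₀ _ hn.ne'] at h
    rw [EReal.coe_le_coe_iff, div_div_eq_mul_div, mul_comm (f _)]
    gcongr
  have hle : ((f (t • w) / t : ℝ) : EReal) ≤ fbar f w :=
    Filter.le_limsup_of_frequently_le
      (hlim.frequently (Filter.Eventually.of_forall hev).frequently)
  rw [hc, EReal.coe_le_coe_iff, div_le_iff₀ ht] at hle
  linarith

theorem map_smul_le_of_fbar_neg {m : ℕ} {f : (Fin m → ℝ) → ℝ}
    (hadd : ∀ u v, f (u + v) ≤ f u + f v) (h0 : f 0 = 0) {w : Fin m → ℝ} {c : ℝ}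
    (hc : fbar f w = (c : EReal)) (hc' : fbar f (-w) = ((-c : ℝ) : EReal)) (t : ℝ) :
    f (t • w) ≤ t * c := by
  rcases lt_trichotomy t 0 with ht | rfl | ht
  · simpa using map_smul_le_of_fbar hadd h0 hc' (neg_pos.2 ht)
  · simp [h0]
  · exact map_smul_le_of_fbar hadd h0 hc ht

theorem fbar_eq_of_map_smul {m : ℕ} {f : (Fin m → ℝ) → ℝ} {w : Fin m → ℝ} {c : ℝ}
    (h : ∀ t : ℝ, f (t • w) = t * c) : fbar f w = (c : EReal) := by
  have hev : (fun δ : ℝ => ((f (δ • w) / δ : ℝ) : EReal)) =ᶠ[nhdsWithin 0 (Set.Ioi 0)]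
      fun _ => (c : EReal) := by
    filter_upwards [self_mem_nhdsWithin] with δ (hδ : 0 < δ)
    rw [h, mul_div_cancel_left₀ _ hδ.ne']
  rw [fbar, Filter.limsup_congr hev, Filter.limsup_const]

theorem IsRegularCone.zero_mem {m : ℕ} {K : Set (Fin m → ℝ)} (hK : IsRegularCone K) : 0 ∈ K := by
  have h : (0 : Fin m → ℝ) ∈ K ∩ (-K) := by
    rw [hK.2.2.2.1]
    rfl
  exact h.1

theorem IsRegularCone.add_mem {m : ℕ} {K : Set (Fin m → ℝ)} (hK : IsRegularCone K)
    {u v : Fin m → ℝ} (hu : u ∈ K) (hv : v ∈ K) : u + v ∈ K := by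
  obtain ⟨-, hconv, hsmul, -, -⟩ := hK
  have h := hsmul _ (hconv hu hv (a := 1 / 2) (b := 1 / 2) (by norm_num) (by norm_num)
    (by norm_num)) 2 (by norm_num)
  rw [smul_add, smul_smul, smul_smul] at h
  norm_num at h
  exact h

open Classical in
/-- The function vanishing on `-K` and equal to `max (f u) 0 + C` elsewhere, for `f`
nonpositive on `-K`. -/
noncomputable def penalty {m : ℕ} (K : Set (Fin m → ℝ)) (f : (Fin m → ℝ) → ℝ) (C : ℝ)
    (u : Fin m → ℝ) : ℝ :=
  max (f u) 0 + if -u ∈ K then 0 else C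

section Penalty

variable {m : ℕ} {K : Set (Fin m → ℝ)} {f : (Fin m → ℝ) → ℝ} {C : ℝ}

theorem le_penalty (hC : 0 ≤ C) (u : Fin m → ℝ) : f u ≤ penalty K f C u := by
  unfold penalty
  split_ifs <;> linarith [le_max_left (f u) 0]

theorem penalty_zero (hK : IsRegularCone K) (h0 : f 0 = 0) : penalty K f C 0 = 0 := by
  simp [penalty, h0, hK.zero_mem]

theorem penalty_add_le (hK : IsRegularCone K) (hadd : ∀ u v, f (u + v) ≤ f u + f v) (hC : 0 ≤ C)
    (u v : Fin m → ℝ) : penalty K f C (u + v) ≤ penalty K f C u + penalty K f C v := by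
  have hmax : max (f (u + v)) 0 ≤ max (f u) 0 + max (f v) 0 :=
    max_le ((hadd u v).trans (add_le_add (le_max_left _ _) (le_max_left _ _)))
      (add_nonneg (le_max_right _ _) (le_max_right _ _))
  have hmem : -u ∈ K → -v ∈ K → -(u + v) ∈ K := fun hu hv => by
    rw [neg_add]
    exact hK.add_mem hu hv
  unfold penalty
  split_ifs <;> first | linarith | (exfalso; tauto)

theorem penalty_mono (hK : IsRegularCone K) (hmono : ∀ u v, u - v ∈ K → f v ≤ f u) (hC : 0 ≤ C)
    (u v : Fin m → ℝ) (huv : u - v ∈ K) : penalty K f C v ≤ penalty K f C u := by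
  have hmax : max (f v) 0 ≤ max (f u) 0 := max_le_max_right 0 (hmono u v huv)
  have hmem : -u ∈ K → -v ∈ K := fun hu => by
    have h := hK.add_mem hu huv
    rwa [neg_add_eq_sub, sub_sub_cancel_left] at h
  unfold penalty
  split_ifs <;> first | linarith | (exfalso; tauto)

end Penalty

section MixedInteger

variable {m n1 n2 : ℕ} (A : Matrix (Fin m) (Fin n1) ℝ) (G : Matrix (Fin m) (Fin n2) ℝ)
  (c : Fin n1 → ℝ) (d : Fin n2 → ℝ)

/-- The map `(x, y) ↦ A x + G y` on mixed-integer points. -/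
def mixedIntegerMap : (Fin n1 → ℤ) × (Fin n2 → ℝ) →+ (Fin m → ℝ) where
  toFun p := A.mulVec (fun i => (p.1 i : ℝ)) + G.mulVec p.2
  map_zero' := by
    ext i
    simp [Matrix.mulVec, dotProduct]
  map_add' p q := by
    ext i
    simp only [Matrix.mulVec, dotProduct, Prod.fst_add, Prod.snd_add, Pi.add_apply, Int.cast_add,
      mul_add, Finset.sum_add_distrib]
    ring

/-- The objective `(x, y) ↦ c · x + d · y` on mixed-integer points. -/
def mixedIntegerObjective : (Fin n1 → ℤ) × (Fin n2 → ℝ) →+ ℝ where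
  toFun p := (∑ i, c i * (p.1 i : ℝ)) + ∑ j, d j * p.2 j
  map_zero' := by simp
  map_add' p q := by
    simp only [Prod.fst_add, Prod.snd_add, Pi.add_apply, Int.cast_add, mul_add,
      Finset.sum_add_distrib]
    ring

theorem mixedIntegerMap_single_fst (j : Fin n1) (z : ℤ) :
    mixedIntegerMap A G (Pi.single j z, 0) = (z : ℝ) • fun i => A i j := by
  ext i
  simp [mixedIntegerMap, Matrix.mulVec, dotProduct, Pi.single_apply, mul_comm]

theorem mixedIntegerMap_single_snd (j : Fin n2) (t : ℝ) :
    mixedIntegerMap A G (0, Pi.single j t) = t • fun i => G i j := by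
  ext i
  simp [mixedIntegerMap, Matrix.mulVec, dotProduct]

theorem mixedIntegerObjective_single_fst (j : Fin n1) (z : ℤ) :
    mixedIntegerObjective c d (Pi.single j z, 0) = z * c j := by
  simp [mixedIntegerObjective, Pi.single_apply, mul_comm]

theorem mixedIntegerObjective_single_snd (j : Fin n2) (t : ℝ) :
    mixedIntegerObjective c d (0, Pi.single j t) = t * d j := by
  simp [mixedIntegerObjective, Pi.single_apply, mul_comm]

variable {A G c d}

/-- Weak duality on the lattice of mixed-integer points. -/
theorem DualFeasible.map_le {K : Set (Fin m → ℝ)} {f : (Fin m → ℝ) → ℝ}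
    (hf : DualFeasible K A G c d f) (p : (Fin n1 → ℤ) × (Fin n2 → ℝ)) :
    f (mixedIntegerMap A G p) ≤ mixedIntegerObjective c d p := by
  obtain ⟨hadd, -, h0, hA, hG⟩ := hf
  have hp : mixedIntegerMap A G p =
      (∑ j, p.1 j • fun i => A i j) + ∑ j, p.2 j • fun i => G i j := by
    ext i
    simp [mixedIntegerMap, Matrix.mulVec, dotProduct, mul_comm]
  rw [hp]
  refine (hadd _ _).trans (add_le_add ?_ ?_)
  · refine (Finset.le_sum_of_subadditive f h0.le hadd _ _).trans
      (Finset.sum_le_sum fun j _ => ?_)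
    have hneg : f (-fun i => A i j) = -f fun i => A i j := by
      rw [(hA j).1]
      exact (hA j).2
    have h := map_zsmul_le_of_subadditive hadd h0 hneg (p.1 j)
    rwa [(hA j).1, mul_comm] at h
  · refine (Finset.le_sum_of_subadditive f h0.le hadd _ _).trans
      (Finset.sum_le_sum fun j _ => ?_)
    rw [mul_comm]
    exact map_smul_le_of_fbar_neg hadd h0 (hG j).1 (hG j).2 (p.2 j)

theorem dualFeasible_of_map_eq {K : Set (Fin m → ℝ)} {F : (Fin m → ℝ) → ℝ}
    (hadd : ∀ u v, F (u + v) ≤ F u + F v) (hmono : ∀ u v, u - v ∈ K → F v ≤ F u)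
    (hF : ∀ p, F (mixedIntegerMap A G p) = mixedIntegerObjective c d p) :
    DualFeasible K A G c d F := by
  have hA : ∀ (j : Fin n1) (z : ℤ), F ((z : ℝ) • fun i => A i j) = z * c j := fun j z => by
    rw [← mixedIntegerMap_single_fst A G, hF, mixedIntegerObjective_single_fst]
  have hG : ∀ (j : Fin n2) (t : ℝ), F (t • fun i => G i j) = t * d j := fun j t => by
    rw [← mixedIntegerMap_single_snd A G, hF, mixedIntegerObjective_single_snd]
  refine ⟨hadd, hmono, by simpa using hF 0, fun j => ⟨by simpa using hA j 1, ?_⟩, fun j =>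
    ⟨fbar_eq_of_map_smul (hG j), fbar_eq_of_map_smul fun t => ?_⟩⟩
  · have h := hA j (-1)
    push_cast at h
    rw [neg_one_smul, neg_one_mul] at h
    exact h
  · have h := hG j (-t)
    rw [neg_smul, ← smul_neg, neg_mul_comm] at h
    exact h

end MixedInteger

theorem cut_dominating_subadditive_function
    {m n1 n2 : ℕ} (K : Set (Fin m → ℝ))
    (A : Matrix (Fin m) (Fin n1) ℝ) (G : Matrix (Fin m) (Fin n2) ℝ)
    (b : Fin m → ℝ) (piv : Fin n1 → ℝ) (gam : Fin n2 → ℝ) (pi0 : ℝ)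
    (hK : IsRegularCone K)
    (hfeas : ∃ (x : Fin n1 → ℤ) (y : Fin n2 → ℝ),
      A.mulVec (fun i => (x i : ℝ)) + G.mulVec y - b ∈ K)
    (hvalid : ∀ (x : Fin n1 → ℤ) (y : Fin n2 → ℝ),
      A.mulVec (fun i => (x i : ℝ)) + G.mulVec y - b ∈ K →
      pi0 ≤ (∑ i, piv i * (x i : ℝ)) + ∑ j, gam j * y j)
    (hf : ∃ f, DualFeasible K A G piv gam f) :
    ∃ F, DualFeasible K A G piv gam F ∧ pi0 ≤ F b := by
  obtain ⟨f, hf⟩ := hf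
  have hle := hf.map_le
  obtain ⟨hadd, hmono, h0, -, -⟩ := hf
  set C : ℝ := max (pi0 - f b) 0
  have hC : 0 ≤ C := le_max_right _ _
  have hbd := le_add_of_subadditive hadd hle (le_penalty (K := K) hC)
  refine ⟨infConvHom (mixedIntegerMap A G) (mixedIntegerObjective piv gam) (penalty K f C),
    dualFeasible_of_map_eq (infConvHom_add_le hbd (penalty_add_le hK hadd hC))
      (infConvHom_mono hbd (penalty_mono hK hmono hC)) fun p => ?_, le_ciInf fun p => ?_⟩
  · refine le_antisymm ?_ ?_
    · simpa [penalty_zero hK h0] using infConvHom_le hbd (mixedIntegerMap A G p) p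
    · rw [← eq_of_subadditive_of_le hadd h0 hle p]
      exact le_infConvHom hbd _
  · by_cases hp : -(b - mixedIntegerMap A G p) ∈ K
    · have h1 : pi0 ≤ mixedIntegerObjective piv gam p :=
        hvalid p.1 p.2 (by rwa [neg_sub] at hp)
      have h2 : 0 ≤ penalty K f C (b - mixedIntegerMap A G p) := by
        rw [penalty, if_pos hp, add_zero]
        exact le_max_right _ _
      linarith
    · have h1 : penalty K f C (b - mixedIntegerMap A G p) =
          max (f (b - mixedIntegerMap A G p)) 0 + C := by
        rw [penalty, if_neg hp]
      have h2 := le_add_of_subadditive hadd hle (fun u => le_max_left (f u) 0) b p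
      have h3 : pi0 - f b ≤ C := le_max_left _ _
      linarith
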